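/- arXiv:1804.02046 — 2 statements merged into one kernel-verified Lean document; each statement's English description precedes it below -/
import Mathlib

section
/- Let n ≥ 1 be an integer and i ∈ {1,2}. Define the polynomials 𝒜_n(x) = ⟨x−α⟩_i^{j+1} + ∑_{k=0}^{j} a_n^{(k)} ⟨x−α⟩_i^k and ℬ_n(x) = ∑_{k=0}^{j} b_n^{(k)} ⟨x−α⟩_i^k. Then the following identity of polynomials holds: ⟨x−α⟩_i^{j+1} · Q_n^{(i)}(x) = 𝒜_n(x) M_n(x) + ℬ_n(x) M_{n−1}(x). -/
open Finset Filter Topology Polynomial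

noncomputable section

/-- Pochhammer symbol `(a)_k = a(a+1)⋯(a+k−1)`. -/
def poch (a : ℝ) (k : ℕ) : ℝ := ∏ m ∈ Finset.range k, (a + m)

/-- Falling factorial `[x]_k = x(x−1)⋯(x−k+1)`. -/
def fall (x : ℝ) (k : ℕ) : ℝ := ∏ m ∈ Finset.range k, (x - m)

/-- `⟨x⟩_i^k`: falling factorial for `i = 1`, Pochhammer symbol for `i = 2`. -/
def br (i : ℕ) (x : ℝ) (k : ℕ) : ℝ := if i = 1 then fall x k else poch x k

/-- Forward (`i = 1`) resp. backward (`i = 2`) difference operator `𝒟_i`. -/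
def Dop (i : ℕ) (f : ℝ → ℝ) : ℝ → ℝ :=
  fun x => if i = 1 then f (x + 1) - f x else f x - f (x - 1)

/-- Iterated difference operator `𝒟_i^k`. -/
def Dk (i k : ℕ) (f : ℝ → ℝ) : ℝ → ℝ := (Dop i)^[k] f

/-- Kronecker delta `δ_{i,m}` (real valued). -/
def kdelta (i m : ℕ) : ℝ := if i = m then 1 else 0

/-- The shift `x ± 1`: `x + 1` for `i = 1`, `x - 1` for `i = 2`. -/
def sh (i : ℕ) (x : ℝ) : ℝ := if i = 1 then x + 1 else x - 1

/-- Monic Meixner polynomial `M_n(x)`. -/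
def MeixnerM (γ μ : ℝ) (n : ℕ) (x : ℝ) : ℝ :=
  poch γ n * (μ / (μ - 1)) ^ n *
    ∑ k ∈ Finset.range (n + 1),
      poch (-(n : ℝ)) k * poch (-x) k / poch γ k * (1 - μ⁻¹) ^ k / (Nat.factorial k : ℝ)

/-- Meixner inner product `⟨p,q⟩ = ∑_{x≥0} p(x)q(x) μ^x (γ)_x / x!`. -/
def mIP (γ μ : ℝ) (p q : ℝ → ℝ) : ℝ :=
  ∑' x : ℕ, p x * q x * μ ^ x * poch γ x / (Nat.factorial x : ℝ)

/-- Squared Meixner norm `‖M_n‖²`. -/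
def nrm2 (γ μ : ℝ) (n : ℕ) : ℝ := mIP γ μ (MeixnerM γ μ n) (MeixnerM γ μ n)

/-- Kernel `K_n^{(l,m)}(x,y)` for the operator `𝒟_i`. -/
def Klm (γ μ : ℝ) (i l m n : ℕ) (x y : ℝ) : ℝ :=
  ∑ k ∈ Finset.range (n + 1),
    Dk i l (MeixnerM γ μ k) x * Dk i m (MeixnerM γ μ k) y / nrm2 γ μ k

/-- Sobolev inner product `⟨p,q⟩_λ = ⟨p,q⟩ + λ 𝒟_i^j p(α) 𝒟_i^j q(α)`. -/
def sIP (γ μ lam α : ℝ) (i j : ℕ) (p q : ℝ → ℝ) : ℝ :=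
  mIP γ μ p q + lam * Dk i j p α * Dk i j q α

/-- `Q` is the monic Sobolev orthogonal polynomial of degree `n`. -/
def IsSobolevOP (γ μ lam α : ℝ) (i j n : ℕ) (Q : Polynomial ℝ) : Prop :=
  Q.Monic ∧ Q.natDegree = n ∧
    ∀ p : Polynomial ℝ, p.degree < (n : WithBot ℕ) →
      sIP γ μ lam α i j (fun x => Q.eval x) (fun x => p.eval x) = 0

/-- Coefficient `a_n^{(k)}`. -/
def acoef (γ μ lam α : ℝ) (i j n k : ℕ) : ℝ :=
  -(lam * (Nat.factorial j : ℝ) * Dk i j (MeixnerM γ μ n) α * Dk i k (MeixnerM γ μ (n - 1)) α) /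
    ((Nat.factorial k : ℝ) * nrm2 γ μ (n - 1) * (1 + lam * Klm γ μ i j j (n - 1) α α))

/-- Coefficient `b_n^{(k)}`. -/
def bcoef (γ μ lam α : ℝ) (i j n k : ℕ) : ℝ :=
  lam * (Nat.factorial j : ℝ) * Dk i j (MeixnerM γ μ n) α * Dk i k (MeixnerM γ μ n) α /
    ((Nat.factorial k : ℝ) * nrm2 γ μ (n - 1) * (1 + lam * Klm γ μ i j j (n - 1) α α))

/-- Rational function `A_{1,n}(x)`. -/
def A1 (γ μ lam α : ℝ) (i j n : ℕ) (x : ℝ) : ℝ :=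
  1 + (1 / br i (x - α) (j + 1)) *
    ∑ k ∈ Finset.range (j + 1), acoef γ μ lam α i j n k * br i (x - α) k

/-- Rational function `B_{1,n}(x)`. -/
def B1 (γ μ lam α : ℝ) (i j n : ℕ) (x : ℝ) : ℝ :=
  (1 / br i (x - α) (j + 1)) *
    ∑ k ∈ Finset.range (j + 1), bcoef γ μ lam α i j n k * br i (x - α) k

/-- Meixner recurrence coefficient `α_n`. -/
def alphaR (γ μ : ℝ) (n : ℕ) : ℝ := ((n : ℝ) * (1 + μ) + μ * γ) / (1 - μ)

/-- Meixner recurrence coefficient `β_n`. -/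
def betaR (γ μ : ℝ) (n : ℕ) : ℝ := (n : ℝ) * μ * ((n : ℝ) + γ - 1) / (1 - μ) ^ 2

/-- Rational function `A_{2,n}(x)`. -/
def A2 (γ μ lam α : ℝ) (i j n : ℕ) (x : ℝ) : ℝ :=
  -(B1 γ μ lam α i j (n - 1) x) / betaR γ μ (n - 1)

/-- Rational function `B_{2,n}(x)`. -/
def B2 (γ μ lam α : ℝ) (i j n : ℕ) (x : ℝ) : ℝ :=
  A1 γ μ lam α i j (n - 1) x + A2 γ μ lam α i j n x * (alphaR γ μ (n - 1) - x)

/-- Rational function `C_{1,n}(x)`. -/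
def C1 (γ μ lam α : ℝ) (i j n : ℕ) (x : ℝ) : ℝ :=
  (x + γ * kdelta i 1) * Dop i (A1 γ μ lam α i j n) x + (n : ℝ) * A1 γ μ lam α i j n (sh i x)
    - ((n : ℝ) - 1) * ((n : ℝ) + γ - 2) * μ ^ kdelta i 2 * B1 γ μ lam α i j n (sh i x) /
        (betaR γ μ (n - 1) * (1 - μ))

/-- Rational function `D_{1,n}(x)`. -/
def D1 (γ μ lam α : ℝ) (i j n : ℕ) (x : ℝ) : ℝ :=
  (x + γ * kdelta i 1) * Dop i (B1 γ μ lam α i j n) x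
    + ((n : ℝ) - 1) * B1 γ μ lam α i j n (sh i x)
    + ((n : ℝ) - 1) * ((n : ℝ) + γ - 2) * (x - alphaR γ μ (n - 1)) * μ ^ kdelta i 2 *
        B1 γ μ lam α i j n (sh i x) / (betaR γ μ (n - 1) * (1 - μ))
    + (n : ℝ) * ((n : ℝ) + γ - 1) * μ ^ kdelta i 2 * A1 γ μ lam α i j n (sh i x) / (1 - μ)

/-- Rational function `C_{2,n}(x)`. -/
def C2 (γ μ lam α : ℝ) (i j n : ℕ) (x : ℝ) : ℝ :=
  -(D1 γ μ lam α i j (n - 1) x) / betaR γ μ (n - 1)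

/-- Rational function `D_{2,n}(x)`. -/
def D2 (γ μ lam α : ℝ) (i j n : ℕ) (x : ℝ) : ℝ :=
  C1 γ μ lam α i j (n - 1) x + C2 γ μ lam α i j n x * (alphaR γ μ (n - 1) - x)

/-- `A_{m,n}(x)` for `m = 1, 2`. -/
def Aa (γ μ lam α : ℝ) (i j n m : ℕ) (x : ℝ) : ℝ :=
  if m = 1 then A1 γ μ lam α i j n x else A2 γ μ lam α i j n x

/-- `B_{m,n}(x)` for `m = 1, 2`. -/
def Bb (γ μ lam α : ℝ) (i j n m : ℕ) (x : ℝ) : ℝ :=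
  if m = 1 then B1 γ μ lam α i j n x else B2 γ μ lam α i j n x

/-- `C_{k,n}(x)` for `k = 1, 2`. -/
def Cc (γ μ lam α : ℝ) (i j n k : ℕ) (x : ℝ) : ℝ :=
  if k = 1 then C1 γ μ lam α i j n x else C2 γ μ lam α i j n x

/-- `D_{k,n}(x)` for `k = 1, 2`. -/
def Dd (γ μ lam α : ℝ) (i j n k : ℕ) (x : ℝ) : ℝ :=
  if k = 1 then D1 γ μ lam α i j n x else D2 γ μ lam α i j n x

/-- `Λ_{m,n}^{(k)}(x) = (−1)^k (C_{k,n}(x) B_{m,n}(x) − A_{m,n}(x) D_{k,n}(x))`. -/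
def Lam (γ μ lam α : ℝ) (i j n m k : ℕ) (x : ℝ) : ℝ :=
  (-1 : ℝ) ^ k * (Cc γ μ lam α i j n k x * Bb γ μ lam α i j n m x
    - Aa γ μ lam α i j n m x * Dd γ μ lam α i j n k x)

/-- `Θ_n(x) = A_{1,n}(x) B_{2,n}(x) − B_{1,n}(x) A_{2,n}(x)`. -/
def Theta (γ μ lam α : ℝ) (i j n : ℕ) (x : ℝ) : ℝ :=
  A1 γ μ lam α i j n x * B2 γ μ lam α i j n x - B1 γ μ lam α i j n x * A2 γ μ lam α i j n x

/-- `Θ̃_n(x) = (x + γ δ_{i,1}) Θ_n(x)`. -/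
def Thetatil (γ μ lam α : ℝ) (i j n : ℕ) (x : ℝ) : ℝ :=
  (x + γ * kdelta i 1) * Theta γ μ lam α i j n x

/-- A sequence of monic polynomials of degrees `0, 1, 2, …`, orthogonal with respect to a positive
definite linear functional `L`. -/
structure IsMonicOPS (L : ℝ[X] →ₗ[ℝ] ℝ) (P : ℕ → ℝ[X]) : Prop where
  monic : ∀ n, (P n).Monic
  natDegree : ∀ n, (P n).natDegree = n
  orthogonal : ∀ (n : ℕ) (p : ℝ[X]), p.degree < (n : WithBot ℕ) → L (P n * p) = 0
  pos : ∀ p, p ≠ 0 → 0 < L (p * p)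

/-- Induction on polynomials of bounded degree along a monic basis. -/
theorem Polynomial.induction_on_monic_basis {b : ℕ → ℝ[X]} (hb : ∀ n, (b n).Monic)
    (hd : ∀ n, (b n).natDegree = n) {n : ℕ} {motive : ℝ[X] → Prop} (zero : motive 0)
    (add : ∀ p c m, m < n → motive p → motive (p + C c * b m)) {p : ℝ[X]}
    (hp : p.degree < (n : WithBot ℕ)) : motive p := by
  suffices h : ∀ m ≤ n, ∀ p : ℝ[X], p.degree < (m : WithBot ℕ) → motive p from h n le_rfl p hp
  intro m
  induction m with
  | zero =>
    intro _ p hp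
    have : p = 0 := by simpa using hp
    exact this ▸ zero
  | succ m ih =>
    intro hm p hp
    have hdeg : (p - C (p.coeff m) * b m).degree < (m : WithBot ℕ) := by
      rw [degree_lt_iff_coeff_zero] at hp ⊢
      intro k hk
      rcases hk.eq_or_lt with rfl | hk
      · have : (b m).coeff m = 1 := by simpa [hd m] using (hb m).coeff_natDegree
        simp [this]
      · have : (b m).coeff k = 0 := coeff_eq_zero_of_natDegree_lt (by rw [hd m]; exact hk)
        simp [this, hp k hk]
    simpa using add _ (p.coeff m) m hm (ih (by omega) _ hdeg)

namespace IsMonicOPS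

variable {L : ℝ[X] →ₗ[ℝ] ℝ} {P : ℕ → ℝ[X]}

theorem degree_eq (h : IsMonicOPS L P) (n : ℕ) : (P n).degree = (n : WithBot ℕ) := by
  rw [degree_eq_natDegree (h.monic n).ne_zero, h.natDegree]

theorem norm_pos (h : IsMonicOPS L P) (n : ℕ) : 0 < L (P n * P n) :=
  h.pos _ (h.monic n).ne_zero

theorem orthogonal_of_ne (h : IsMonicOPS L P) {m n : ℕ} (hmn : m ≠ n) : L (P m * P n) = 0 := by
  rcases hmn.lt_or_gt with hlt | hlt
  · rw [mul_comm]
    exact h.orthogonal n _ (by rw [h.degree_eq]; exact_mod_cast hlt)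
  · exact h.orthogonal m _ (by rw [h.degree_eq]; exact_mod_cast hlt)

/-- A linear functional evaluated through the Fourier expansion in the orthogonal basis. -/
theorem apply_eq_sum (h : IsMonicOPS L P) (T : ℝ[X] →ₗ[ℝ] ℝ) {n : ℕ} {p : ℝ[X]}
    (hp : p.degree < (n : WithBot ℕ)) :
    T p = ∑ k ∈ Finset.range n, T (P k) * L (P k * p) / L (P k * P k) := by
  refine Polynomial.induction_on_monic_basis (motive := fun p => T p =
    ∑ k ∈ Finset.range n, T (P k) * L (P k * p) / L (P k * P k)) h.monic h.natDegree ?_ ?_ hp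
  · simp
  · intro p c m hm ih
    have hsum : ∑ k ∈ Finset.range n, T (P k) * L (P k * (C c * P m)) / L (P k * P k)
        = c * T (P m) := by
      rw [Finset.sum_eq_single m]
      · rw [mul_left_comm, ← smul_eq_C_mul, map_smul, smul_eq_mul]
        have := (h.norm_pos m).ne'
        field_simp
      · intro k _ hk
        rw [mul_left_comm, ← smul_eq_C_mul, map_smul, h.orthogonal_of_ne hk]
        simp
      · intro hm'
        exact absurd (Finset.mem_range.2 hm) hm'
    simp only [mul_add, map_add, add_div, Finset.sum_add_distrib]
    rw [hsum, ← ih, ← smul_eq_C_mul, map_smul, smul_eq_mul]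

theorem eq_zero_of_orthogonal (h : IsMonicOPS L P) {n : ℕ} {r : ℝ[X]}
    (hr : r.degree < (n : WithBot ℕ)) (horth : ∀ k < n, L (P k * r) = 0) : r = 0 := by
  by_contra hne
  have h1 := h.pos r hne
  have h2 := h.apply_eq_sum (L ∘ₗ LinearMap.mulLeft ℝ r) hr
  rw [Finset.sum_eq_zero] at h2
  · simp at h2
    linarith
  · intro k hk
    simp [horth k (Finset.mem_range.1 hk)]

theorem sub_degree_lt (h : IsMonicOPS L P) {n : ℕ} {q : ℝ[X]} (hq : q.Monic)
    (hd : q.natDegree = n) : (q - P n).degree < (n : WithBot ℕ) := by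
  have hqd : q.degree = (n : WithBot ℕ) := by rw [degree_eq_natDegree hq.ne_zero, hd]
  rw [← hqd]
  exact degree_sub_lt_left (by rw [hqd, h.degree_eq]) hq.ne_zero (by rw [hq.leadingCoeff, h.monic n])

/-- The inner product of `P n` with a monic polynomial of degree `n` is the squared norm. -/
theorem apply_mul_monic (h : IsMonicOPS L P) {n : ℕ} {q : ℝ[X]} (hq : q.Monic)
    (hd : q.natDegree = n) : L (P n * q) = L (P n * P n) := by
  have := h.orthogonal n _ (h.sub_degree_lt hq hd)
  rw [mul_sub, map_sub] at this
  linarith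

/-- Three-term recurrence relation. -/
theorem recurrence (h : IsMonicOPS L P) (n : ℕ) :
    X * P (n + 1) = P (n + 2) + C (L (P (n + 1) * (X * P (n + 1))) / L (P (n + 1) * P (n + 1))) *
      P (n + 1) + C (L (P (n + 1) * P (n + 1)) / L (P n * P n)) * P n := by
  set a := L (P (n + 1) * (X * P (n + 1))) / L (P (n + 1) * P (n + 1)) with ha
  set b := L (P (n + 1) * P (n + 1)) / L (P n * P n) with hb
  have hXm : ∀ k, (X * P k).Monic := fun k => monic_X.mul (h.monic k)
  have hXd : ∀ k, (X * P k).natDegree = k + 1 := fun k => by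
    rw [monic_X.natDegree_mul (h.monic k), natDegree_X, h.natDegree, add_comm]
  have hn := (h.norm_pos n).ne'
  have hn1 := (h.norm_pos (n + 1)).ne'
  have hr : (X * P (n + 1) - P (n + 2) - (C a * P (n + 1) + C b * P n)).degree
      < ((n + 2 : ℕ) : WithBot ℕ) := by
    refine (degree_sub_le _ _).trans_lt (max_lt (h.sub_degree_lt (hXm _) (hXd _)) ?_)
    refine (degree_add_le _ _).trans_lt (max_lt ?_ ?_) <;>
    · rw [← smul_eq_C_mul]
      refine (degree_smul_le _ _).trans_lt ?_
      rw [h.degree_eq]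
      norm_cast
      omega
  have hzero := h.eq_zero_of_orthogonal hr ?_
  · linear_combination hzero
  intro k hk
  have hexp : L (P k * (X * P (n + 1) - P (n + 2) - (C a * P (n + 1) + C b * P n)))
      = L (P (n + 1) * (X * P k)) - L (P k * P (n + 2)) - a * L (P k * P (n + 1))
        - b * L (P k * P n) := by
    have : P k * (X * P (n + 1) - P (n + 2) - (C a * P (n + 1) + C b * P n))
        = P (n + 1) * (X * P k) - P k * P (n + 2) - a • (P k * P (n + 1)) - b • (P k * P n) := by
      simp only [smul_eq_C_mul]
      ring
    rw [this]
    simp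
  rw [hexp, h.orthogonal_of_ne (by omega : k ≠ n + 2)]
  rcases (by omega : k = n + 1 ∨ k = n ∨ k < n) with rfl | rfl | hk
  · rw [h.orthogonal_of_ne (by omega : n + 1 ≠ n), ha]
    field_simp
    ring
  · rw [h.orthogonal_of_ne (by omega : k ≠ k + 1), h.apply_mul_monic (hXm k) (hXd k), hb]
    field_simp
    ring
  · rw [h.orthogonal_of_ne (by omega : k ≠ n + 1), h.orthogonal_of_ne (by omega : k ≠ n),
      h.orthogonal (n + 1)]
    · simp
    · rw [degree_eq_natDegree (hXm k).ne_zero, hXd]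
      exact_mod_cast (by omega : k + 1 < n + 1)

/-- **Christoffel–Darboux formula**. -/
theorem christoffel_darboux (h : IsMonicOPS L P) (n : ℕ) (x y : ℝ) :
    (x - y) * ∑ k ∈ Finset.range (n + 1), (P k).eval x * (P k).eval y / L (P k * P k) =
      ((P (n + 1)).eval x * (P n).eval y - (P n).eval x * (P (n + 1)).eval y) / L (P n * P n) := by
  induction n with
  | zero =>
    have h0 : P 0 = 1 := (h.monic 0).natDegree_eq_zero.1 (h.natDegree 0)
    have h1 : P 1 = X + C ((P 1).coeff 0) := by
      have := (h.monic 1).eq_X_add_C (h.natDegree 1)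
      exact this
    rw [zero_add, Finset.sum_range_one, h1, h0]
    simp
    ring
  | succ n ih =>
    have hr := h.recurrence n
    set a := L (P (n + 1) * (X * P (n + 1))) / L (P (n + 1) * P (n + 1))
    have hx := congrArg (Polynomial.eval x) hr
    have hy := congrArg (Polynomial.eval y) hr
    simp only [eval_mul, eval_add, eval_X, eval_C] at hx hy
    have hn := (h.norm_pos n).ne'
    have hn1 := (h.norm_pos (n + 1)).ne'
    rw [Finset.sum_range_succ, mul_add, ih]
    field_simp at hx hy ⊢
    linear_combination (P (n + 1)).eval y * hx - (P (n + 1)).eval x * hy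

/-- The monic polynomial orthogonal with respect to `L` perturbed by a rank-one Sobolev term is an
explicit correction of the original orthogonal polynomial. -/
theorem eq_of_sobolev_orthogonal (h : IsMonicOPS L P) (T : ℝ[X] →ₗ[ℝ] ℝ) {lam : ℝ}
    (hlam : 0 < lam) {n : ℕ} {Q : ℝ[X]} (hQ : Q.Monic) (hd : Q.natDegree = n)
    (horth : ∀ p : ℝ[X], p.degree < (n : WithBot ℕ) → L (Q * p) + lam * T Q * T p = 0) :
    Q = P n - C (lam * T (P n) /
        (1 + lam * ∑ k ∈ Finset.range n, T (P k) * T (P k) / L (P k * P k))) *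
      ∑ k ∈ Finset.range n, C (T (P k) / L (P k * P k)) * P k := by
  set κ := ∑ k ∈ Finset.range n, T (P k) * T (P k) / L (P k * P k) with hκ
  set R := ∑ k ∈ Finset.range n, C (T (P k) / L (P k * P k)) * P k with hR
  have hκ0 : 0 ≤ κ := Finset.sum_nonneg fun k _ =>
    div_nonneg (mul_self_nonneg _) (h.norm_pos k).le
  have hden : 1 + lam * κ ≠ 0 := by positivity
  set c := lam * T (P n) / (1 + lam * κ) with hc
  have hRd : R.degree < (n : WithBot ℕ) := by
    rw [← mem_degreeLT, hR]
    refine Submodule.sum_mem _ fun k hk => ?_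
    rw [← smul_eq_C_mul]
    refine Submodule.smul_mem _ _ (mem_degreeLT.2 ?_)
    rw [h.degree_eq]
    exact_mod_cast Finset.mem_range.1 hk
  have hTR : T R = κ := by
    rw [hR, hκ, map_sum]
    refine Finset.sum_congr rfl fun k _ => ?_
    rw [← smul_eq_C_mul, map_smul, smul_eq_mul]
    ring
  have hLR : ∀ p : ℝ[X], p.degree < (n : WithBot ℕ) → L (R * p) = T p := fun p hp => by
    rw [h.apply_eq_sum T hp, hR, Finset.sum_mul, map_sum]
    refine Finset.sum_congr rfl fun k _ => ?_
    rw [mul_assoc, ← smul_eq_C_mul, map_smul, smul_eq_mul]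
    ring
  set E := Q - (P n - C c * R) with hE
  have hEd : E.degree < (n : WithBot ℕ) := by
    have : E = (Q - P n) + c • R := by rw [hE, smul_eq_C_mul]; ring
    rw [this]
    exact (degree_add_le _ _).trans_lt
      (max_lt (h.sub_degree_lt hQ hd) ((degree_smul_le _ _).trans_lt hRd))
  have hEE : L (E * E) + lam * T E * T E = 0 := by
    have e1 : L (E * E) = L (Q * E) - L (P n * E) + c * L (R * E) := by
      have : E * E = Q * E - P n * E + c • (R * E) := by
        rw [smul_eq_C_mul]
        nth_rewrite 1 [hE]
        ring
      rw [this]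
      simp
    have e2 : T E = T Q - T (P n) + c * κ := by
      have : E = Q - P n + c • R := by rw [hE, smul_eq_C_mul]; ring
      rw [this]
      simp [hTR]
    have e3 : c = lam * (T (P n) - c * κ) := by
      rw [hc]
      field_simp
      ring
    have h1 := horth E hEd
    rw [h.orthogonal n E hEd, hLR E hEd] at e1
    linear_combination e1 + h1 + T E * e3 + lam * T E * e2
  have hE0 : E = 0 := by
    by_contra hne
    have := h.pos E hne
    nlinarith [mul_nonneg hlam.le (mul_self_nonneg (T E))]
  linear_combination hE0

end IsMonicOPS

theorem Dk_succ_apply (i k : ℕ) (f : ℝ → ℝ) (y : ℝ) :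
    Dk i (k + 1) f y =
      if i = 1 then Dk i k f (y + 1) - Dk i k f y else Dk i k f y - Dk i k f (y - 1) := by
  rw [Dk, Function.iterate_succ_apply']
  rfl

/-- The functional `p ↦ 𝒟_i^k p(y)` on polynomials. -/
def differenceFunctional (i k : ℕ) (y : ℝ) : ℝ[X] →ₗ[ℝ] ℝ where
  toFun p := Dk i k (fun z => p.eval z) y
  map_add' p q := by
    induction k generalizing y with
    | zero => simp [Dk]
    | succ k ih => simp only [Dk_succ_apply, ih]; split_ifs <;> ring
  map_smul' c p := by
    induction k generalizing y with
    | zero => simp [Dk]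
    | succ k ih =>
      simp only [Dk_succ_apply, ih, RingHom.id_apply, smul_eq_mul]; split_ifs <;> ring

theorem differenceFunctional_apply (i k : ℕ) (y : ℝ) (p : ℝ[X]) :
    differenceFunctional i k y p = Dk i k (fun z => p.eval z) y := rfl

theorem br_succ (i : ℕ) (z : ℝ) (k : ℕ) :
    br i z (k + 1) = br i z k * (z - (if i = 1 then 1 else -1) * k) := by
  unfold br fall poch
  split_ifs <;> rw [Finset.prod_range_succ] <;> ring

/-- Leibniz rule for the difference operators and a linear factor. -/
theorem Dk_sub_mul (i k : ℕ) (x y : ℝ) (f : ℝ → ℝ) :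
    Dk i (k + 1) (fun z => (x - z) * f z) y =
      (x - y - (if i = 1 then 1 else -1) * (k + 1 : ℕ)) * Dk i (k + 1) f y
        - (k + 1) * Dk i k f y := by
  induction k generalizing y with
  | zero =>
    rw [Dk_succ_apply, Dk_succ_apply]
    simp only [Dk, Function.iterate_zero, id_eq]
    split_ifs <;> push_cast <;> ring
  | succ k ih =>
    have h := Dk_succ_apply i k f y
    have h' := Dk_succ_apply i (k + 1) f y
    rw [Dk_succ_apply]
    simp only [ih]
    split_ifs with hi
    · simp only [hi, if_true] at h h' ⊢
      push_cast
      linear_combination -(x - y - (k + 2)) * h' + (k + 1) * h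
    · simp only [hi, if_false] at h h' ⊢
      push_cast
      linear_combination -(x - y + (k + 2)) * h' + (k + 1) * h

theorem br_mul_Dk_eq_sum (i j : ℕ) (x y : ℝ) (f : ℝ → ℝ) :
    br i (x - y) (j + 1) * Dk i j f y = (j.factorial : ℝ) *
      ∑ k ∈ Finset.range (j + 1),
        Dk i k (fun z => (x - z) * f z) y / (k.factorial : ℝ) * br i (x - y) k := by
  induction j with
  | zero => simp [Dk, br, fall, poch]
  | succ j ih =>
    rw [Finset.sum_range_succ, mul_add, Dk_sub_mul, Nat.factorial_succ]
    have hf : (j.factorial : ℝ) ≠ 0 := by positivity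
    have hj : (j : ℝ) + 1 ≠ 0 := by positivity
    have hb := br_succ i (x - y) (j + 1)
    push_cast at hb ⊢
    rw [mul_assoc, ← ih, hb]
    field_simp
    ring

theorem poch_pos {s : ℝ} (hs : 0 < s) (n : ℕ) : 0 < poch s n :=
  Finset.prod_pos fun _ _ => by positivity

theorem poch_add (s : ℝ) (m n : ℕ) : poch s (m + n) = poch s m * poch (s + m) n := by
  unfold poch
  rw [Finset.prod_range_add]
  congr 1
  exact Finset.prod_congr rfl fun _ _ => by push_cast; ring

theorem poch_neg (x : ℝ) (k : ℕ) : poch (-x) k = (-1) ^ k * fall x k := by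
  unfold poch fall
  rw [← Finset.card_range k, ← Finset.prod_const, Finset.card_range, ← Finset.prod_mul_distrib]
  exact Finset.prod_congr rfl fun _ _ => by ring

theorem fall_natCast (n k : ℕ) : fall n k = (n.descFactorial k : ℝ) := by
  induction k with
  | zero => simp [fall]
  | succ k ih =>
    have : fall n (k + 1) = fall n k * (n - k) := Finset.prod_range_succ _ _
    rw [this, ih, Nat.descFactorial_succ]
    rcases le_or_gt k n with h | h
    · push_cast [Nat.cast_sub h]
      ring
    · simp [Nat.descFactorial_of_lt h]

/-- The Meixner weight `μ^x (s)_x / x!`. -/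
def meixnerWeight (s μ : ℝ) (x : ℕ) : ℝ := μ ^ x * poch s x / (x.factorial : ℝ)

section Weight

variable {s μ : ℝ}

theorem meixnerWeight_pos (hs : 0 < s) (hμ0 : 0 < μ) (x : ℕ) : 0 < meixnerWeight s μ x := by
  have := poch_pos hs x
  unfold meixnerWeight
  positivity

theorem summable_meixnerWeight (hs : 0 < s) (hμ0 : 0 < μ) (hμ1 : μ < 1) :
    Summable (meixnerWeight s μ) := by
  refine summable_of_ratio_test_tendsto_lt_one hμ1
    (Eventually.of_forall fun x => (meixnerWeight_pos hs hμ0 x).ne') ?_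
  have hratio : ∀ x : ℕ, ‖meixnerWeight s μ (x + 1)‖ / ‖meixnerWeight s μ x‖
      = μ * (1 + (s - 1) * (1 / ((x : ℝ) + 1))) := fun x => by
    rw [Real.norm_of_nonneg (meixnerWeight_pos hs hμ0 _).le,
      Real.norm_of_nonneg (meixnerWeight_pos hs hμ0 _).le]
    have h1 : poch s (x + 1) = poch s x * (s + x) := Finset.prod_range_succ _ _
    have h2 := (poch_pos hs x).ne'
    unfold meixnerWeight
    rw [h1, Nat.factorial_succ]
    push_cast
    field_simp
    ring
  simp only [hratio]
  simpa using (((tendsto_one_div_add_atTop_nhds_zero_nat (𝕜 := ℝ)).const_mul (s - 1)).const_add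
    1).const_mul μ

theorem tsum_meixnerWeight_succ (hs : 0 < s) (hμ0 : 0 < μ) (hμ1 : μ < 1) :
    (1 - μ) * ∑' x, meixnerWeight (s + 1) μ x = ∑' x, meixnerWeight s μ x := by
  have h0 := summable_meixnerWeight hs hμ0 hμ1
  have h1 := summable_meixnerWeight (s := s + 1) (by linarith) hμ0 hμ1
  rw [h0.tsum_eq_zero_add, sub_mul, one_mul, ← tsum_mul_left]
  nth_rewrite 1 [h1.tsum_eq_zero_add]
  rw [add_sub_assoc, ← ((summable_nat_add_iff 1).2 h1).tsum_sub (h1.mul_left μ)]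
  have e0 : ∀ t, meixnerWeight t μ 0 = 1 := fun t => by simp [meixnerWeight, poch]
  rw [e0, e0]
  refine congrArg _ (tsum_congr fun x => ?_)
  have e1 : poch (s + 1) (x + 1) = poch (s + 1) x * (s + 1 + x) := Finset.prod_range_succ _ _
  have e2 : poch s (x + 1) = s * poch (s + 1) x := by
    rw [add_comm x 1, poch_add]
    simp [poch]
  unfold meixnerWeight
  rw [e1, e2, Nat.factorial_succ]
  push_cast
  field_simp
  ring

theorem tsum_meixnerWeight_add (hs : 0 < s) (hμ0 : 0 < μ) (hμ1 : μ < 1) (k : ℕ) :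
    (1 - μ) ^ k * ∑' x, meixnerWeight (s + k) μ x = ∑' x, meixnerWeight s μ x := by
  induction k with
  | zero => simp
  | succ k ih =>
    have h := tsum_meixnerWeight_succ (s := s + k) (by positivity) hμ0 hμ1
    rw [← ih, ← h]
    push_cast
    rw [← add_assoc]
    ring

/-- The monic polynomial `(s + X)_m`. -/
def pochPoly (s : ℝ) (m : ℕ) : ℝ[X] := ∏ l ∈ Finset.range m, (X + C (s + l))

theorem pochPoly_monic (s : ℝ) (m : ℕ) : (pochPoly s m).Monic :=
  monic_prod_of_monic _ _ fun _ _ => monic_X_add_C _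

theorem pochPoly_natDegree (s : ℝ) (m : ℕ) : (pochPoly s m).natDegree = m := by
  rw [pochPoly, natDegree_prod_of_monic _ _ fun _ _ => monic_X_add_C _]
  simp only [natDegree_X_add_C, Finset.sum_const, Finset.card_range, smul_eq_mul, mul_one]

theorem pochPoly_eval (s : ℝ) (m : ℕ) (x : ℝ) : (pochPoly s m).eval x = poch (s + x) m := by
  rw [pochPoly, eval_prod, poch]
  exact Finset.prod_congr rfl fun _ _ => by simp; ring

/-- The monic polynomial `[X]_m`. -/
def fallPoly (m : ℕ) : ℝ[X] := ∏ l ∈ Finset.range m, (X - C (l : ℝ))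

theorem fallPoly_monic (m : ℕ) : (fallPoly m).Monic :=
  monic_prod_of_monic _ _ fun _ _ => monic_X_sub_C _

theorem fallPoly_natDegree (m : ℕ) : (fallPoly m).natDegree = m := by
  rw [fallPoly, natDegree_prod_of_monic _ _ fun _ _ => monic_X_sub_C _]
  simp only [natDegree_X_sub_C, Finset.sum_const, Finset.card_range, smul_eq_mul, mul_one]

theorem fallPoly_eval (m : ℕ) (x : ℝ) : (fallPoly m).eval x = fall x m := by
  rw [fallPoly, eval_prod, fall]
  exact Finset.prod_congr rfl fun _ _ => by simp

theorem poch_mul_meixnerWeight (s μ : ℝ) (m x : ℕ) :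
    poch (s + x) m * meixnerWeight s μ x = poch s m * meixnerWeight (s + m) μ x := by
  have h := poch_add s x m
  rw [add_comm x m, poch_add] at h
  unfold meixnerWeight
  linear_combination -μ ^ x / (x.factorial : ℝ) * h

theorem summable_eval_mul_meixnerWeight (hs : 0 < s) (hμ0 : 0 < μ) (hμ1 : μ < 1) (p : ℝ[X]) :
    Summable fun x : ℕ => p.eval (x : ℝ) * meixnerWeight s μ x := by
  refine Polynomial.induction_on_monic_basis (b := pochPoly s) (n := p.natDegree + 1)
    (motive := fun p => Summable fun x : ℕ => p.eval (x : ℝ) * meixnerWeight s μ x)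
    (pochPoly_monic s) (pochPoly_natDegree s) ?_ ?_ ?_
  · simp
  · intro p c m _ hp
    have h := ((summable_meixnerWeight (s := s + m) (by positivity) hμ0 hμ1).mul_left
      (poch s m)).mul_left c
    refine (hp.add h).congr fun x => ?_
    rw [← poch_mul_meixnerWeight, eval_add, eval_mul, eval_C, pochPoly_eval]
    ring
  · exact degree_le_natDegree.trans_lt (by exact_mod_cast Nat.lt_succ_self _)

/-- The Meixner moment functional `p ↦ ∑_x p(x) μ^x (s)_x / x!`. -/
def meixnerFunctional (hs : 0 < s) (hμ0 : 0 < μ) (hμ1 : μ < 1) : ℝ[X] →ₗ[ℝ] ℝ where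
  toFun p := ∑' x : ℕ, p.eval (x : ℝ) * meixnerWeight s μ x
  map_add' p q := by
    rw [← (summable_eval_mul_meixnerWeight hs hμ0 hμ1 p).tsum_add
      (summable_eval_mul_meixnerWeight hs hμ0 hμ1 q)]
    exact tsum_congr fun x => by rw [eval_add, add_mul]
  map_smul' c p := by
    rw [RingHom.id_apply, smul_eq_mul, ← tsum_mul_left]
    exact tsum_congr fun x => by rw [eval_smul, smul_eq_mul, mul_assoc]

theorem meixnerFunctional_mul (hs : 0 < s) (hμ0 : 0 < μ) (hμ1 : μ < 1) (p q : ℝ[X]) :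
    meixnerFunctional hs hμ0 hμ1 (p * q) =
      mIP s μ (fun x => p.eval x) (fun x => q.eval x) :=
  tsum_congr fun x => by
    rw [eval_mul, meixnerWeight]
    ring

theorem meixnerFunctional_mul_self_pos (hs : 0 < s) (hμ0 : 0 < μ) (hμ1 : μ < 1) {p : ℝ[X]}
    (hp : p ≠ 0) : 0 < meixnerFunctional hs hμ0 hμ1 (p * p) := by
  obtain ⟨x, hx⟩ : ∃ x : ℕ, p.eval (x : ℝ) ≠ 0 := by
    by_contra! h
    refine hp (eq_zero_of_infinite_isRoot p ?_)
    exact (Set.infinite_range_of_injective (Nat.cast_injective (R := ℝ))).mono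
      (by rintro _ ⟨x, rfl⟩; exact h x)
  refine (summable_eval_mul_meixnerWeight hs hμ0 hμ1 (p * p)).tsum_pos (fun y => ?_) x ?_
  · rw [eval_mul]
    exact mul_nonneg (mul_self_nonneg _) (meixnerWeight_pos hs hμ0 y).le
  · rw [eval_mul]
    exact mul_pos (mul_self_pos.2 hx) (meixnerWeight_pos hs hμ0 x)

/-- Mixed factorial moments of the Meixner weight. -/
theorem meixnerFunctional_fallPoly_mul_pochPoly (hs : 0 < s) (hμ0 : 0 < μ) (hμ1 : μ < 1)
    (k m : ℕ) : (1 - μ) ^ (k + m) *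
      meixnerFunctional hs hμ0 hμ1 (fallPoly k * pochPoly s m) =
      μ ^ k * poch s (k + m) * ∑' x, meixnerWeight s μ x := by
  have hsum := summable_eval_mul_meixnerWeight hs hμ0 hμ1 (fallPoly k * pochPoly s m)
  have hval : meixnerFunctional hs hμ0 hμ1 (fallPoly k * pochPoly s m)
      = ∑' x : ℕ, μ ^ k * poch s (k + m) * meixnerWeight (s + (k + m : ℕ)) μ x := by
    change ∑' x : ℕ, _ = _
    rw [← hsum.sum_add_tsum_nat_add k, Finset.sum_eq_zero, zero_add]
    · refine tsum_congr fun y => ?_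
      have hfac : ((y + k).factorial : ℝ) = y.factorial * ((y + k).descFactorial k : ℝ) := by
        have := Nat.factorial_mul_descFactorial (Nat.le_add_left k y)
        rw [Nat.add_sub_cancel] at this
        exact_mod_cast this.symm
      have hd : ((y + k).descFactorial k : ℝ) ≠ 0 := by
        exact_mod_cast (Nat.descFactorial_eq_zero_iff_lt.not.2 (by omega))
      have hp : poch s (y + k) * poch (s + (y + k : ℕ)) m
          = poch s (k + m) * poch (s + (k + m : ℕ)) y := by
        rw [← poch_add, ← poch_add]
        congr 1
        omega
      rw [eval_mul, fallPoly_eval, pochPoly_eval, fall_natCast, meixnerWeight, meixnerWeight, hfac,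
        pow_add]
      field_simp
      linear_combination hp
    · intro x hx
      rw [eval_mul, fallPoly_eval, fall_natCast,
        Nat.descFactorial_of_lt (Finset.mem_range.1 hx)]
      simp
  rw [hval, tsum_mul_left, ← tsum_meixnerWeight_add hs hμ0 hμ1 (k + m)]
  ring

/-- The monic Meixner polynomial as a polynomial, expanded in falling factorials. -/
def meixnerPoly (γ μ : ℝ) (n : ℕ) : ℝ[X] :=
  ∑ k ∈ Finset.range (n + 1), C (poch γ n * (μ / (μ - 1)) ^ n *
    ((n.choose k : ℝ) * (1 - μ⁻¹) ^ k / poch γ k)) * fallPoly k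

theorem poch_neg_natCast_mul (n k : ℕ) (x : ℝ) :
    poch (-(n : ℝ)) k * poch (-x) k = (n.choose k : ℝ) * (k.factorial : ℝ) * fall x k := by
  rw [poch_neg, poch_neg, fall_natCast, Nat.descFactorial_eq_factorial_mul_choose]
  have : ((-1 : ℝ) ^ k) * (-1) ^ k = 1 := by rw [← mul_pow]; simp
  push_cast
  linear_combination (n.choose k : ℝ) * (k.factorial : ℝ) * fall x k * this

theorem meixnerPoly_eval (γ μ : ℝ) (n : ℕ) (x : ℝ) :
    (meixnerPoly γ μ n).eval x = MeixnerM γ μ n x := by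
  rw [meixnerPoly, eval_finsetSum, MeixnerM, Finset.mul_sum]
  refine Finset.sum_congr rfl fun k _ => ?_
  have hf : (k.factorial : ℝ) ≠ 0 := by positivity
  rw [eval_mul, eval_C, fallPoly_eval, poch_neg_natCast_mul]
  field_simp

theorem meixnerPoly_sub_fallPoly (hs : 0 < s) (hμ0 : 0 < μ) (hμ1 : μ < 1) (n : ℕ) :
    ∃ q : ℝ[X], q.degree < (n : WithBot ℕ) ∧ meixnerPoly s μ n = q + fallPoly n := by
  refine ⟨∑ k ∈ Finset.range n, C (poch s n * (μ / (μ - 1)) ^ n *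
    ((n.choose k : ℝ) * (1 - μ⁻¹) ^ k / poch s k)) * fallPoly k, ?_, ?_⟩
  · rw [← mem_degreeLT]
    refine Submodule.sum_mem _ fun k hk => ?_
    rw [← smul_eq_C_mul]
    refine Submodule.smul_mem _ _ (mem_degreeLT.2 ?_)
    rw [degree_eq_natDegree (fallPoly_monic k).ne_zero, fallPoly_natDegree]
    exact_mod_cast Finset.mem_range.1 hk
  · have h1 := (poch_pos hs n).ne'
    have h2 : μ / (μ - 1) * (1 - μ⁻¹) = 1 := by
      have : μ - 1 ≠ 0 := by linarith
      field_simp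
    have h3 : poch s n * (μ / (μ - 1)) ^ n * ((n.choose n : ℝ) * (1 - μ⁻¹) ^ n / poch s n) = 1 := by
      rw [Nat.choose_self, Nat.cast_one, one_mul, mul_div_assoc', mul_assoc, ← mul_pow, h2]
      simp [h1]
    rw [meixnerPoly, Finset.sum_range_succ, h3, C_1, one_mul]

theorem meixnerPoly_monic (hs : 0 < s) (hμ0 : 0 < μ) (hμ1 : μ < 1) (n : ℕ) :
    (meixnerPoly s μ n).Monic := by
  obtain ⟨q, hq, h⟩ := meixnerPoly_sub_fallPoly hs hμ0 hμ1 n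
  rw [h]
  refine (fallPoly_monic n).add_of_right ?_
  rwa [degree_eq_natDegree (fallPoly_monic n).ne_zero, fallPoly_natDegree]

theorem meixnerPoly_natDegree (hs : 0 < s) (hμ0 : 0 < μ) (hμ1 : μ < 1) (n : ℕ) :
    (meixnerPoly s μ n).natDegree = n := by
  obtain ⟨q, hq, h⟩ := meixnerPoly_sub_fallPoly hs hμ0 hμ1 n
  have hd : (fallPoly n).degree = (n : WithBot ℕ) := by
    rw [degree_eq_natDegree (fallPoly_monic n).ne_zero, fallPoly_natDegree]
  rw [h, natDegree_eq_of_degree_eq (degree_add_eq_right_of_degree_lt (hd ▸ hq)),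
    fallPoly_natDegree]

/-- Alternating binomial sums annihilate polynomials of low degree. -/
theorem sum_alternating_choose_mul_eval (n : ℕ) {p : ℝ[X]} (hp : p.natDegree < n) :
    ∑ k ∈ Finset.range (n + 1), (-1 : ℝ) ^ k * (n.choose k : ℝ) * p.eval (k : ℝ) = 0 := by
  have h := congrFun (Polynomial.fwdDiff_iter_eq_zero_of_degree_lt hp) 0
  rw [fwdDiff_iter_eq_sum_shift] at h
  have h' := congrArg (fun t => (-1 : ℝ) ^ n * t) h
  simp only [Finset.mul_sum, Pi.zero_apply, mul_zero] at h'
  rw [← h']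
  refine Finset.sum_congr rfl fun k hk => ?_
  have hk' : k ≤ n := Nat.lt_succ_iff.1 (Finset.mem_range.1 hk)
  have hs : (-1 : ℝ) ^ n * (-1) ^ (n - k) = (-1) ^ k := by
    obtain ⟨d, rfl⟩ := Nat.exists_eq_add_of_le hk'
    rw [Nat.add_sub_cancel_left, pow_add, mul_assoc, ← mul_pow]
    simp
  rw [← hs]
  simp [zsmul_eq_mul]
  ring

theorem meixnerFunctional_meixnerPoly_mul_pochPoly (hs : 0 < s) (hμ0 : 0 < μ) (hμ1 : μ < 1)
    {m n : ℕ} (hmn : m < n) :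
    meixnerFunctional hs hμ0 hμ1 (meixnerPoly s μ n * pochPoly s m) = 0 := by
  have hμ : 1 - μ ≠ 0 := by linarith
  rw [meixnerPoly, Finset.sum_mul, map_sum]
  have hterm : ∀ k, meixnerFunctional hs hμ0 hμ1 (C (poch s n * (μ / (μ - 1)) ^ n *
      ((n.choose k : ℝ) * (1 - μ⁻¹) ^ k / poch s k)) * fallPoly k * pochPoly s m)
      = poch s n * (μ / (μ - 1)) ^ n * (∑' x, meixnerWeight s μ x) / (1 - μ) ^ m *
        ((-1 : ℝ) ^ k * (n.choose k : ℝ) * (pochPoly s m).eval (k : ℝ)) := fun k => by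
    have hk := (poch_pos hs k).ne'
    have hmom := meixnerFunctional_fallPoly_mul_pochPoly hs hμ0 hμ1 k m
    have hpow : (1 - μ⁻¹) ^ k * μ ^ k = (-1) ^ k * (1 - μ) ^ k := by
      rw [← mul_pow, ← mul_pow]
      congr 1
      field_simp
      ring
    have hval : meixnerFunctional hs hμ0 hμ1 (fallPoly k * pochPoly s m)
        = μ ^ k * poch s (k + m) * (∑' x, meixnerWeight s μ x) / (1 - μ) ^ (k + m) := by
      rw [eq_div_iff (pow_ne_zero _ hμ), mul_comm, hmom]
    rw [mul_assoc, ← smul_eq_C_mul, map_smul, smul_eq_mul, hval, pochPoly_eval, poch_add, pow_add]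
    generalize ∑' x, meixnerWeight s μ x = Z
    generalize (μ / (μ - 1)) ^ n = w
    generalize 1 - μ⁻¹ = v at hpow
    field_simp
    linear_combination poch s n * w * (n.choose k : ℝ) * Z * poch (s + k) m * hpow
  simp only [hterm]
  rw [← Finset.mul_sum, sum_alternating_choose_mul_eval n (by rwa [pochPoly_natDegree]), mul_zero]

/-- The Meixner polynomials are orthogonal with respect to the Meixner functional. -/
theorem isMonicOPS_meixnerPoly (hs : 0 < s) (hμ0 : 0 < μ) (hμ1 : μ < 1) :
    IsMonicOPS (meixnerFunctional hs hμ0 hμ1) (meixnerPoly s μ) where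
  monic := meixnerPoly_monic hs hμ0 hμ1
  natDegree := meixnerPoly_natDegree hs hμ0 hμ1
  orthogonal n p hp := by
    refine Polynomial.induction_on_monic_basis
      (motive := fun p => meixnerFunctional hs hμ0 hμ1 (meixnerPoly s μ n * p) = 0)
      (pochPoly_monic s) (pochPoly_natDegree s) (by simp) ?_ hp
    intro p c m hm ih
    rw [mul_add, map_add, ih, mul_left_comm, ← smul_eq_C_mul, map_smul,
      meixnerFunctional_meixnerPoly_mul_pochPoly hs hμ0 hμ1 hm]
    simp
  pos _ hp := meixnerFunctional_mul_self_pos hs hμ0 hμ1 hp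

end Weight

/-- `⟨x−α⟩_i^{j+1} Q_n^{(i)}(x) = 𝒜_n(x) M_n(x) + ℬ_n(x) M_{n−1}(x)`. -/
theorem sobolev_polynomial_connection (γ μ lam α : ℝ) (hγ : 0 < γ) (hμ0 : 0 < μ)
    (hμ1 : μ < 1) (hlam : 0 < lam) (hα : α ≤ 0) (j i n : ℕ) (hi : i = 1 ∨ i = 2)
    (hn : 1 ≤ n) (Q : Polynomial ℝ) (hQ : IsSobolevOP γ μ lam α i j n Q) :
    ∀ x : ℝ, br i (x - α) (j + 1) * Q.eval x =
      (br i (x - α) (j + 1) +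
          ∑ k ∈ Finset.range (j + 1), acoef γ μ lam α i j n k * br i (x - α) k) *
        MeixnerM γ μ n x +
      (∑ k ∈ Finset.range (j + 1), bcoef γ μ lam α i j n k * br i (x - α) k) *
        MeixnerM γ μ (n - 1) x := by
  intro x
  obtain ⟨m, rfl⟩ : ∃ m, n = m + 1 := ⟨n - 1, by omega⟩
  obtain ⟨hQm, hQd, hQo⟩ := hQ
  have hP := isMonicOPS_meixnerPoly hγ hμ0 hμ1
  set L := meixnerFunctional hγ hμ0 hμ1
  set P := meixnerPoly γ μ
  have hM : ∀ k, (fun z => (P k).eval z) = MeixnerM γ μ k := fun k =>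
    funext (meixnerPoly_eval γ μ k)
  have hN : ∀ k, nrm2 γ μ k = L (P k * P k) := fun k => by
    rw [meixnerFunctional_mul, hM, nrm2]
  have hD : ∀ l k, Dk i l (MeixnerM γ μ k) α = differenceFunctional i l α (P k) := fun l k => by
    rw [differenceFunctional_apply, hM]
  have hMx : ∀ k, MeixnerM γ μ k x = (P k).eval x := fun k => (meixnerPoly_eval γ μ k x).symm
  have hQ := hP.eq_of_sobolev_orthogonal (differenceFunctional i j α) hlam hQm hQd
    fun p hp => by
      rw [meixnerFunctional_mul]
      exact hQo p hp
  simp only [acoef, bcoef, Klm, Nat.add_sub_cancel, hN, hD, hMx]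
  set κ := ∑ k ∈ Finset.range (m + 1), differenceFunctional i j α (P k) *
    differenceFunctional i j α (P k) / L (P k * P k)
  clear_value κ
  set K : ℝ[X] := ∑ k ∈ Finset.range (m + 1), C ((P k).eval x / L (P k * P k)) * P k with hK
  have hKD : differenceFunctional i j α K = (∑ k ∈ Finset.range (m + 1),
      C (differenceFunctional i j α (P k) / L (P k * P k)) * P k).eval x := by
    rw [hK, map_sum, eval_finsetSum]
    refine Finset.sum_congr rfl fun k _ => ?_
    rw [← smul_eq_C_mul, map_smul, smul_eq_mul, eval_mul, eval_C]
    ring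
  have hCD : (fun z => (x - z) * K.eval z) = fun z =>
      (((P (m + 1)).eval x / L (P m * P m)) • P m -
        ((P m).eval x / L (P m * P m)) • P (m + 1)).eval z := by
    funext z
    have h := hP.christoffel_darboux m x z
    have hKz : K.eval z = ∑ k ∈ Finset.range (m + 1),
        (P k).eval x * (P k).eval z / L (P k * P k) := by
      rw [hK, eval_finsetSum]
      refine Finset.sum_congr rfl fun k _ => ?_
      rw [eval_mul, eval_C]
      ring
    rw [hKz, h]
    simp
    ring
  have hsum := br_mul_Dk_eq_sum i j x α fun z => K.eval z
  rw [hCD, ← differenceFunctional_apply, hKD] at hsum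
  simp only [← differenceFunctional_apply, map_sub, map_smul, smul_eq_mul] at hsum
  rw [hQ, eval_sub, eval_mul, eval_C, mul_sub, mul_left_comm, hsum, sub_eq_add_neg, add_mul,
    add_assoc, ← mul_assoc, ← neg_mul, Finset.mul_sum, Finset.sum_mul, Finset.sum_mul,
    ← Finset.sum_add_distrib]
  congr 1
  refine Finset.sum_congr rfl fun k _ => ?_
  simp only [div_eq_mul_inv, mul_inv]
  ring
end
end

section
/- ((2j+3)-term recurrence relation.) Let n ≥ j+1 be an integer and i ∈ {1,2}, and define the Fourier coefficients c_{n,k} = ⟨⟨x−α⟩_i^{j+1} Q_n^{(i)}(x), Q_k^{(i)}(x)⟩_λ / ‖Q_k^{(i)}‖_λ² for 0 ≤ k ≤ n+j. Then c_{n,k} = 0 for all 0 ≤ k ≤ n−j−2, and consequently the following identity of polynomials holds: ⟨x−α⟩_i^{j+1} · Q_n^{(i)}(x) = Q_{n+j+1}^{(i)}(x) + ∑_{k=n−j−1}^{n+j} c_{n,k} Q_k^{(i)}(x). -/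
open Finset Filter Topology Polynomial

noncomputable section

lemma poch_pos_s15 {γ : ℝ} (hγ : 0 < γ) (x : ℕ) : 0 < poch γ x :=
  Finset.prod_pos fun _ _ => by positivity

/-- All moments of the Meixner weight converge. -/
lemma summable_pow_mul_weight {γ μ : ℝ} (hγ : 0 < γ) (hμ0 : 0 < μ) (hμ1 : μ < 1) (d : ℕ) :
    Summable fun x : ℕ => (x : ℝ) ^ d * (μ ^ x * poch γ x / (Nat.factorial x : ℝ)) := by
  have hpos : ∀ x : ℕ, 0 < μ ^ x * poch γ x / (Nat.factorial x : ℝ) := fun x => by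
    have := poch_pos_s15 hγ x
    positivity
  refine summable_of_ratio_test_tendsto_lt_one hμ1 ?_ ?_
  · filter_upwards [eventually_gt_atTop 0] with x hx
    have := (hpos x).ne'
    positivity
  · have hinv : Tendsto (fun x : ℕ => (x : ℝ)⁻¹) atTop (𝓝 0) :=
      tendsto_inv_atTop_nhds_zero_nat
    have hlim : Tendsto (fun x : ℕ => (1 + (x : ℝ)⁻¹) ^ d *
        (μ * ((γ * (x : ℝ)⁻¹ + 1) / (1 + (x : ℝ)⁻¹)))) atTop
        (𝓝 ((1 + 0) ^ d * (μ * ((γ * 0 + 1) / (1 + 0))))) :=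
      ((hinv.const_add 1).pow d).mul
        ((((hinv.const_mul γ).add_const 1).div (hinv.const_add 1) (by norm_num)).const_mul μ)
    norm_num at hlim
    refine hlim.congr' ?_
    filter_upwards [eventually_gt_atTop 0] with x hx
    have hx' : (0 : ℝ) < x := by exact_mod_cast hx
    have hp := poch_pos_s15 hγ x
    have hs : poch γ (x + 1) = poch γ x * (γ + x) := Finset.prod_range_succ _ _
    have h1 := hpos (x + 1)
    rw [Real.norm_of_nonneg (by positivity), Real.norm_of_nonneg
      (mul_nonneg (by positivity) (hpos x).le), hs, Nat.factorial_succ]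
    have hb : (1 : ℝ) + (x : ℝ)⁻¹ = ((x : ℝ) + 1) / x := by field_simp
    rw [hb, div_pow]
    push_cast
    field_simp
    ring

/-- The Meixner functional is absolutely convergent on every polynomial. -/
lemma summable_eval_mul_weight {γ μ : ℝ} (hγ : 0 < γ) (hμ0 : 0 < μ) (hμ1 : μ < 1)
    (p : ℝ[X]) :
    Summable fun x : ℕ => p.eval (x : ℝ) * (μ ^ x * poch γ x / (Nat.factorial x : ℝ)) := by
  induction p using Polynomial.induction_on' with
  | add p q hp hq => simpa only [Polynomial.eval_add, add_mul] using hp.add hq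
  | monomial d a =>
    simpa only [Polynomial.eval_monomial, mul_assoc] using
      (summable_pow_mul_weight hγ hμ0 hμ1 d).mul_left a

lemma summable_mIP {γ μ : ℝ} (hγ : 0 < γ) (hμ0 : 0 < μ) (hμ1 : μ < 1) (p q : ℝ[X]) :
    Summable fun x : ℕ =>
      p.eval (x : ℝ) * q.eval (x : ℝ) * μ ^ x * poch γ x / (Nat.factorial x : ℝ) := by
  simpa only [Polynomial.eval_mul, mul_assoc, mul_div_assoc] using
    summable_eval_mul_weight hγ hμ0 hμ1 (p * q)

lemma Dk_add (i k : ℕ) (f g : ℝ → ℝ) : Dk i k (f + g) = Dk i k f + Dk i k g := by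
  induction k generalizing f g with
  | zero => rfl
  | succ k ih =>
    have h : Dop i (f + g) = Dop i f + Dop i g := by
      ext x
      simp only [Dop, Pi.add_apply]
      split_ifs <;> ring
    simpa only [Dk, Function.iterate_succ_apply, h] using ih (Dop i f) (Dop i g)

lemma Dk_smul (i k : ℕ) (a : ℝ) (f : ℝ → ℝ) : Dk i k (a • f) = a • Dk i k f := by
  induction k generalizing f with
  | zero => rfl
  | succ k ih =>
    have h : Dop i (a • f) = a • Dop i f := by
      ext x
      simp only [Dop, Pi.smul_apply, smul_eq_mul]
      split_ifs <;> ring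
    simpa only [Dk, Function.iterate_succ_apply, h] using ih (Dop i f)

lemma Dk_one_eq_zero {k : ℕ} {f : ℝ → ℝ} {x : ℝ} (h : ∀ m ≤ k, f (x + m) = 0) :
    Dk 1 k f x = 0 := by
  induction k generalizing f with
  | zero => simpa [Dk] using h 0 le_rfl
  | succ k ih =>
    rw [Dk, Function.iterate_succ_apply]
    refine ih fun m hm => ?_
    have h1 := h (m + 1) (by omega)
    have h0 := h m (by omega)
    push_cast at h1
    simp [Dop, h0, add_assoc, h1]

lemma Dk_two_eq_zero {k : ℕ} {f : ℝ → ℝ} {x : ℝ} (h : ∀ m ≤ k, f (x - m) = 0) :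
    Dk 2 k f x = 0 := by
  induction k generalizing f with
  | zero => simpa [Dk] using h 0 le_rfl
  | succ k ih =>
    rw [Dk, Function.iterate_succ_apply]
    refine ih fun m hm => ?_
    have h1 := h (m + 1) (by omega)
    have h0 := h m (by omega)
    push_cast at h1
    simp [Dop, h0, sub_sub, h1]

/-- The factor `⟨x - α⟩_i^{j+1}` annihilates the discrete part of the Sobolev product. -/
lemma Dk_br_mul_eq_zero {i : ℕ} (hi : i = 1 ∨ i = 2) (j : ℕ) (α : ℝ) (f : ℝ → ℝ) :
    Dk i j (fun x => br i (x - α) (j + 1) * f x) α = 0 := by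
  rcases hi with rfl | rfl
  · refine Dk_one_eq_zero fun m hm => mul_eq_zero_of_left ?_ _
    simp only [br, if_true, fall]
    exact Finset.prod_eq_zero (Finset.mem_range.2 (Nat.lt_succ_of_le hm)) (by ring)
  · refine Dk_two_eq_zero fun m hm => mul_eq_zero_of_left ?_ _
    simp only [br, OfNat.ofNat_ne_one, if_false, poch]
    exact Finset.prod_eq_zero (Finset.mem_range.2 (Nat.lt_succ_of_le hm)) (by ring)

/-- `⟨x - α⟩_i^k` is a monic polynomial of degree `k`. -/
lemma exists_monic_eval_eq_br (i k : ℕ) (α : ℝ) :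
    ∃ b : ℝ[X], b.Monic ∧ b.natDegree = k ∧ ∀ x, b.eval x = br i (x - α) k := by
  have key : ∀ r : ℕ → ℝ, (∏ m ∈ Finset.range k, (X - C (r m)) : ℝ[X]).Monic ∧
      (∏ m ∈ Finset.range k, (X - C (r m)) : ℝ[X]).natDegree = k := fun r =>
    ⟨monic_prod_X_sub_C _ _, by simp⟩
  by_cases h : i = 1
  · refine ⟨_, (key fun m => α + m).1, (key fun m => α + m).2, fun x => ?_⟩
    rw [br, if_pos h, fall, Polynomial.eval_prod]
    refine Finset.prod_congr rfl fun m _ => ?_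
    simp only [eval_sub, eval_X, eval_C]
    ring
  · refine ⟨_, (key fun m => α - m).1, (key fun m => α - m).2, fun x => ?_⟩
    rw [br, if_neg h, poch, Polynomial.eval_prod]
    refine Finset.prod_congr rfl fun m _ => ?_
    simp only [eval_sub, eval_X, eval_C]
    ring

lemma sIP_comm (γ μ lam α : ℝ) (i j : ℕ) (f g : ℝ → ℝ) :
    sIP γ μ lam α i j f g = sIP γ μ lam α i j g f := by
  simp only [sIP, mIP, mul_comm (f _) (g _)]
  ring

lemma sIP_add_left {γ μ : ℝ} (hγ : 0 < γ) (hμ0 : 0 < μ) (hμ1 : μ < 1) (lam α : ℝ) (i j : ℕ)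
    (p q r : ℝ[X]) :
    sIP γ μ lam α i j (fun x => (p + q).eval x) (fun x => r.eval x) =
      sIP γ μ lam α i j (fun x => p.eval x) (fun x => r.eval x) +
        sIP γ μ lam α i j (fun x => q.eval x) (fun x => r.eval x) := by
  have hD : Dk i j (fun x => (p + q).eval x) = Dk i j (fun x => p.eval x) +
      Dk i j (fun x => q.eval x) := by
    rw [← Dk_add]
    congr 1
    ext x
    simp
  simp only [sIP, hD, Pi.add_apply, mIP]
  simp only [eval_add, add_mul, add_div,
    (summable_mIP hγ hμ0 hμ1 p r).tsum_add (summable_mIP hγ hμ0 hμ1 q r)]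
  ring

lemma sIP_smul_left (γ μ lam α : ℝ) (i j : ℕ) (a : ℝ) (p q : ℝ[X]) :
    sIP γ μ lam α i j (fun x => (a • p).eval x) (fun x => q.eval x) =
      a * sIP γ μ lam α i j (fun x => p.eval x) (fun x => q.eval x) := by
  have hD : Dk i j (fun x => (a • p).eval x) = a • Dk i j (fun x => p.eval x) := by
    rw [← Dk_smul]
    congr 1
    ext x
    simp
  simp only [sIP, hD, Pi.smul_apply, smul_eq_mul, mIP]
  simp only [eval_smul, smul_eq_mul, mul_assoc, mul_div_assoc, tsum_mul_left]
  ring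

/-- The Sobolev inner product as a bilinear form on polynomials. -/
def sobolevForm {γ μ : ℝ} (hγ : 0 < γ) (hμ0 : 0 < μ) (hμ1 : μ < 1) (lam α : ℝ) (i j : ℕ) :
    ℝ[X] →ₗ[ℝ] ℝ[X] →ₗ[ℝ] ℝ :=
  LinearMap.mk₂ ℝ (fun p q => sIP γ μ lam α i j (fun x => p.eval x) (fun x => q.eval x))
    (fun p q r => sIP_add_left hγ hμ0 hμ1 lam α i j p q r)
    (fun a p q => sIP_smul_left γ μ lam α i j a p q)
    (fun p q r => by
      simp only [sIP_comm γ μ lam α i j (fun x => p.eval x)]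
      exact sIP_add_left hγ hμ0 hμ1 lam α i j q r p)
    (fun a p q => by
      simp only [sIP_comm γ μ lam α i j (fun x => p.eval x)]
      exact sIP_smul_left γ μ lam α i j a q p)

lemma sobolevForm_apply {γ μ : ℝ} (hγ : 0 < γ) (hμ0 : 0 < μ) (hμ1 : μ < 1) (lam α : ℝ)
    (i j : ℕ) (p q : ℝ[X]) : sobolevForm hγ hμ0 hμ1 lam α i j p q =
      sIP γ μ lam α i j (fun x => p.eval x) (fun x => q.eval x) := rfl

lemma sIP_self_pos {γ μ lam : ℝ} (hγ : 0 < γ) (hμ0 : 0 < μ) (hμ1 : μ < 1) (hlam : 0 < lam)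
    (α : ℝ) (i j : ℕ) {p : ℝ[X]} (hp : p ≠ 0) :
    0 < sIP γ μ lam α i j (fun x => p.eval x) (fun x => p.eval x) := by
  have hw : ∀ x : ℕ, 0 < μ ^ x * poch γ x / (Nat.factorial x : ℝ) := fun x => by
    have := poch_pos_s15 hγ x
    positivity
  have hnat : ∃ x : ℕ, p.eval (x : ℝ) ≠ 0 := by
    by_contra! h
    refine hp (Polynomial.eq_zero_of_infinite_isRoot p ?_)
    exact (Set.infinite_range_of_injective (Nat.cast_injective (R := ℝ))).mono
      (by rintro _ ⟨x, rfl⟩; exact h x)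
  obtain ⟨x, hx⟩ := hnat
  have hm : 0 < mIP γ μ (fun x => p.eval x) (fun x => p.eval x) := by
    refine (summable_mIP hγ hμ0 hμ1 p p).tsum_pos (fun y => ?_) x ?_
    · rw [mul_assoc, mul_div_assoc]
      exact mul_nonneg (mul_self_nonneg _) (hw y).le
    · rw [mul_assoc, mul_div_assoc]
      exact mul_pos (mul_self_pos.2 hx) (hw x)
  rw [sIP, mul_assoc]
  exact add_pos_of_pos_of_nonneg hm (mul_nonneg hlam.le (mul_self_nonneg _))

/-- A polynomial of degree less than `N` that is orthogonal to a monic orthogonal family up to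
degree `N - 1` vanishes. -/
lemma eq_zero_of_orthogonal (B : ℝ[X] →ₗ[ℝ] ℝ[X] →ₗ[ℝ] ℝ) (Q : ℕ → ℝ[X])
    (hmonic : ∀ k, (Q k).Monic) (hdeg : ∀ k, (Q k).natDegree = k)
    (horth : ∀ (k : ℕ) (p : ℝ[X]), p.degree < (k : WithBot ℕ) → B p (Q k) = 0)
    (hne : ∀ k, B (Q k) (Q k) ≠ 0) {N : ℕ} {R : ℝ[X]} (hR : R.degree < (N : WithBot ℕ))
    (h : ∀ k < N, B R (Q k) = 0) : R = 0 := by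
  by_contra hR0
  set d := R.natDegree with hd
  have hdN : d < N := (Polynomial.natDegree_lt_iff_degree_lt hR0).2 hR
  have hlc : R.leadingCoeff ≠ 0 := leadingCoeff_ne_zero.2 hR0
  have hdegR : R.degree = d := degree_eq_natDegree hR0
  have hlow : (R - R.leadingCoeff • Q d).degree < (d : WithBot ℕ) := by
    rw [← hdegR]
    refine degree_sub_lt_left ?_ hR0 ?_
    · rw [degree_smul_of_smul_regular _ (IsSMulRegular.of_ne_zero hlc),
        degree_eq_natDegree (hmonic d).ne_zero, hdeg, hdegR]
    · rw [smul_eq_C_mul, leadingCoeff_mul, leadingCoeff_C, (hmonic d).leadingCoeff, mul_one]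
  have h0 := horth d _ hlow
  rw [map_sub, LinearMap.sub_apply, h d hdN, map_smul, LinearMap.smul_apply, smul_eq_mul,
    zero_sub, neg_eq_zero, mul_eq_zero] at h0
  exact h0.elim hlc (hne d)

/-- the `(2j+3)`-term recurrence relation. -/
theorem sobolev_recurrence_relation (γ μ lam α : ℝ) (hγ : 0 < γ) (hμ0 : 0 < μ)
    (hμ1 : μ < 1) (hlam : 0 < lam) (hα : α ≤ 0) (j i n : ℕ) (hi : i = 1 ∨ i = 2)
    (hn : j + 1 ≤ n) (Q : ℕ → Polynomial ℝ)
    (hQ : ∀ m : ℕ, IsSobolevOP γ μ lam α i j m (Q m)) (c : ℕ → ℝ)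
    (hc : ∀ k : ℕ, c k =
      sIP γ μ lam α i j (fun x => br i (x - α) (j + 1) * (Q n).eval x)
          (fun x => (Q k).eval x) /
        sIP γ μ lam α i j (fun x => (Q k).eval x) (fun x => (Q k).eval x)) :
    (∀ k : ℕ, k + (j + 2) ≤ n → c k = 0) ∧
    ∀ x : ℝ, br i (x - α) (j + 1) * (Q n).eval x =
      (Q (n + j + 1)).eval x +
        ∑ k ∈ Finset.Icc (n - j - 1) (n + j), c k * (Q k).eval x := by
  obtain ⟨b, hbm, hbd, hb⟩ := exists_monic_eval_eq_br i (j + 1) α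
  set B := sobolevForm hγ hμ0 hμ1 lam α i j with hB
  have hmul : ∀ p : ℝ[X], (fun x => br i (x - α) (j + 1) * p.eval x) =
      fun x => (b * p).eval x := fun p => by
    ext x
    rw [eval_mul, hb]
  have horth : ∀ (k : ℕ) (p : ℝ[X]), p.degree < (k : WithBot ℕ) → B p (Q k) = 0 := fun k p hp => by
    rw [hB, sobolevForm_apply, sIP_comm]
    exact (hQ k).2.2 p hp
  have hdegQ : ∀ k : ℕ, (Q k).degree = k := fun k => by
    rw [degree_eq_natDegree (hQ k).1.ne_zero, (hQ k).2.1]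
  have hne : ∀ k, B (Q k) (Q k) ≠ 0 := fun k =>
    (sIP_self_pos hγ hμ0 hμ1 hlam α i j (hQ k).1.ne_zero).ne'
  have hsymm : ∀ p q, B (b * p) q = B p (b * q) := fun p q => by
    simp only [hB, sobolevForm_apply, sIP]
    simp only [← hmul, Dk_br_mul_eq_zero hi, mIP]
    simp only [mul_zero, zero_mul, add_zero]
    refine tsum_congr fun x => ?_
    rw [eval_mul, eval_mul]
    ring
  have hc' : ∀ k, c k = B (b * Q n) (Q k) / B (Q k) (Q k) := fun k => by
    rw [hc, hmul]
    rfl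
  have hdegb : ∀ k, (b * Q k).degree = ((j + 1 + k : ℕ) : WithBot ℕ) := fun k => by
    rw [degree_eq_natDegree (hbm.mul (hQ k).1).ne_zero, hbm.natDegree_mul (hQ k).1, hbd,
      (hQ k).2.1]
  have hlow : ∀ k : ℕ, k + (j + 2) ≤ n → B (b * Q n) (Q k) = 0 := fun k hk => by
    rw [hsymm, hB, sobolevForm_apply]
    refine (hQ n).2.2 _ ?_
    rw [hdegb]
    exact_mod_cast (by omega : j + 1 + k < n)
  refine ⟨fun k hk => by rw [hc', hlow k hk, zero_div], ?_⟩
  have hoff : ∀ k l, k ≠ l → B (Q k) (Q l) = 0 := fun k l hkl => by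
    rcases lt_or_gt_of_ne hkl with h | h
    · exact horth l _ (by rw [hdegQ]; exact_mod_cast h)
    · exact (hQ k).2.2 _ (by rw [hdegQ]; exact_mod_cast h)
  have hR : b * Q n - Q (n + j + 1) - ∑ k ∈ Finset.Icc (n - j - 1) (n + j), c k • Q k = 0 := by
    refine eq_zero_of_orthogonal B Q (fun k => (hQ k).1) (fun k => (hQ k).2.1) horth hne
      (N := n + j + 1) ?_ fun k hk => ?_
    · refine (degree_sub_le _ _).trans_lt (max_lt ?_ ?_)
      · have hdeg : (b * Q n).degree = (Q (n + j + 1)).degree := by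
          rw [hdegb, hdegQ]
          congr 1
          omega
        rw [← hdegQ (n + j + 1), ← hdeg]
        refine degree_sub_lt_left hdeg (hbm.mul (hQ n).1).ne_zero ?_
        rw [(hbm.mul (hQ n).1).leadingCoeff, (hQ _).1.leadingCoeff]
      · refine (degree_sum_le _ _).trans_lt ((Finset.sup_lt_iff (WithBot.bot_lt_coe _)).2 ?_)
        intro k hk
        refine (degree_smul_le _ _).trans_lt ?_
        rw [hdegQ]
        exact_mod_cast (by have := (Finset.mem_Icc.1 hk).2; omega : k < n + j + 1)
    · simp only [map_sub, map_sum, map_smul, LinearMap.sub_apply, LinearMap.sum_apply,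
        LinearMap.smul_apply, smul_eq_mul]
      rw [hoff (n + j + 1) k (by omega), sub_zero, sub_eq_zero]
      by_cases hkm : k ∈ Finset.Icc (n - j - 1) (n + j)
      · rw [Finset.sum_eq_single_of_mem k hkm fun l _ hl => by rw [hoff l k hl, mul_zero], hc',
          div_mul_cancel₀ _ (hne k)]
      · rw [hlow k (by rw [Finset.mem_Icc] at hkm; omega)]
        refine (Finset.sum_eq_zero fun l hl => ?_).symm
        rw [hoff l k (by rintro rfl; exact hkm hl), mul_zero]
  intro x
  have hx := congrArg (Polynomial.eval x) hR
  simp only [eval_sub, eval_mul, hb, eval_finsetSum, eval_smul, smul_eq_mul, eval_zero] at hx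
  linarith
end
end
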